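/- Let K be an algebraically closed field of characteristic 0, let f ∈ K[x] be a polynomial of degree at least 2, and let n be a positive integer. If ℓ ∈ K[x] is a degree-1 polynomial such that f^{∘n} ∘ ℓ = L ∘ f^{∘n} for some degree-1 polynomial L, then there exists a degree-1 polynomial L_1 with f ∘ ℓ = L_1 ∘ f. In other words, Γ(f^{∘n}) is contained in Γ(f). -/

import Mathlib

open Polynomial

/-- The Chebyshev polynomial `T_n` satisfying `T_n(x + 1/x) = x^n + 1/x^n`
(the Dickson polynomial of the first kind with parameter 1). -/
noncomputable def cheb (K : Type*) [CommRing K] (n : ℕ) : K[X] :=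
  Polynomial.dickson 1 1 n

/-- The `n`-fold compositional iterate of a polynomial. -/
noncomputable def polyIter {K : Type*} [CommRing K] (f : K[X]) : ℕ → K[X]
  | 0 => X
  | n + 1 => f.comp (polyIter f n)

/-- `f` is linearly conjugate to `g`, i.e. `f = ℓ ∘ g ∘ ℓ⁻¹` for a degree-1 polynomial `ℓ`. -/
def LinConj {K : Type*} [CommRing K] (f g : K[X]) : Prop :=
  ∃ ℓ ℓi : K[X], ℓ.degree = 1 ∧ ℓi.degree = 1 ∧ ℓ.comp ℓi = X ∧ ℓi.comp ℓ = X ∧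
    f = ℓ.comp (g.comp ℓi)

/-- A polynomial is disintegrated if it has degree `δ ≥ 2` and is not linearly conjugate
to `x^δ` or `±T_δ(x)`. -/
def Disintegrated {K : Type*} [CommRing K] (f : K[X]) : Prop :=
  2 ≤ f.natDegree ∧ ¬ LinConj f (X ^ f.natDegree) ∧
    ¬ LinConj f (cheb K f.natDegree) ∧ ¬ LinConj f (-(cheb K f.natDegree))

/-- `η` (of degree at least 2) is semiconjugate to `f` if `f ∘ p = p ∘ η` for some
non-constant polynomial `p`. -/
def SemiconjTo {K : Type*} [CommRing K] (η f : K[X]) : Prop :=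
  ∃ p : K[X], 0 < p.natDegree ∧ f.comp p = p.comp η

/-- `f ≈ g`: there exist `N ≥ 1` and a polynomial `η` (of degree at least 2) semiconjugate
to both `f^{∘N}` and `g^{∘N}`. -/
def PolyApprox {K : Type*} [CommRing K] (f g : K[X]) : Prop :=
  ∃ N : ℕ, 1 ≤ N ∧ ∃ η : K[X], 2 ≤ η.natDegree ∧
    SemiconjTo η (polyIter f N) ∧ SemiconjTo η (polyIter g N)

lemma polyIter_succ_right {K : Type*} [CommRing K] (f : K[X]) (n : ℕ) :
    polyIter f (n + 1) = (polyIter f n).comp f := by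
  induction n with
  | zero => simp [polyIter]
  | succ k ih =>
    rw [polyIter, ih, ← comp_assoc, ← polyIter, ih]

lemma natDegree_polyIter_pos {K : Type*} [Field K] (f : K[X]) (hf : 0 < f.natDegree) (n : ℕ) :
    0 < (polyIter f n).natDegree := by
  induction n with
  | zero => simp [polyIter]
  | succ k ih =>
    rw [polyIter, natDegree_comp]
    positivity

/-- degree of the divided difference `(A(B) - A(U)) / (B - U)` when `B`, `U` have the same
leading term. -/
lemma exists_factor {K : Type*} [Field K] [CharZero K] (A B U : K[X]) (m : ℕ) (hm : 0 < m)
    (u : K) (hu : u ≠ 0) (hA : 0 < A.natDegree)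
    (hB : B.natDegree ≤ m) (hU : U.natDegree ≤ m) (hBu : B.coeff m = u) (hUu : U.coeff m = u) :
    ∃ S : K[X], S ≠ 0 ∧ S.natDegree = (A.natDegree - 1) * m ∧
      A.comp B - A.comp U = S * (B - U) := by
  set k := A.natDegree with hk
  let S : K[X] := ∑ i ∈ Finset.range (k + 1),
    C (A.coeff i) * ∑ j ∈ Finset.range i, B ^ j * U ^ (i - 1 - j)
  have hterm : ∀ i j, j < i → (B ^ j * U ^ (i - 1 - j)).natDegree ≤ (i - 1) * m := by
    intro i j hj
    refine natDegree_mul_le.trans ?_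
    have h1 := natDegree_pow_le_of_le j hB
    have h2 := natDegree_pow_le_of_le (i - 1 - j) hU
    calc _ ≤ j * m + (i - 1 - j) * m := by omega
      _ = (i - 1) * m := by rw [← add_mul]; congr 1; omega
  have hinner : ∀ i, (C (A.coeff i) * ∑ j ∈ Finset.range i, B ^ j * U ^ (i - 1 - j)).natDegree
      ≤ (i - 1) * m := by
    intro i
    refine (natDegree_C_mul_le _ _).trans ?_
    exact natDegree_sum_le_of_forall_le _ _ (fun j hj => hterm i j (Finset.mem_range.1 hj))
  have hSle : S.natDegree ≤ (k - 1) * m := by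
    refine natDegree_sum_le_of_forall_le _ _ (fun i hi => (hinner i).trans ?_)
    have := Finset.mem_range.1 hi
    exact Nat.mul_le_mul_right _ (by omega)
  have hcoef : S.coeff ((k - 1) * m) = A.coeff k * (k * u ^ (k - 1)) := by
    rw [finsetSum_coeff, Finset.sum_range_succ, Finset.sum_eq_zero, zero_add]
    · rw [coeff_C_mul, finsetSum_coeff, Finset.sum_congr rfl (g := fun _ => u ^ (k - 1))]
      · simp
      · intro j hj
        have hj := Finset.mem_range.1 hj
        have e : (k - 1) * m = j * m + (k - 1 - j) * m := by
          rw [← add_mul]; congr 1; omega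
        rw [e, coeff_mul_add_eq_of_natDegree_le (natDegree_pow_le_of_le j hB)
          (natDegree_pow_le_of_le _ hU), coeff_pow_of_natDegree_le hB,
          coeff_pow_of_natDegree_le hU, hBu, hUu, ← pow_add]
        congr 1; omega
    · intro i hi
      have hi := Finset.mem_range.1 hi
      rcases Nat.eq_zero_or_pos i with rfl | hi0
      · simp
      · apply coeff_eq_zero_of_natDegree_lt
        refine (hinner i).trans_lt ?_
        exact Nat.mul_lt_mul_of_pos_right (by omega) hm
  have hne : S.coeff ((k - 1) * m) ≠ 0 := by
    rw [hcoef]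
    have : A.coeff k ≠ 0 := by
      rw [hk, coeff_natDegree, Ne, leadingCoeff_eq_zero]
      intro h0
      rw [hk, h0, natDegree_zero] at hA
      exact lt_irrefl _ hA
    have hk0 : (k : K) ≠ 0 := by exact_mod_cast hA.ne'
    exact mul_ne_zero this (mul_ne_zero hk0 (pow_ne_zero _ hu))
  refine ⟨S, ?_, le_antisymm hSle (le_natDegree_of_ne_zero hne), ?_⟩
  · intro h0
    rw [h0] at hne
    simp at hne
  · rw [comp, comp, eval₂_eq_sum_range, eval₂_eq_sum_range, ← Finset.sum_sub_distrib,
      Finset.sum_mul]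
    refine Finset.sum_congr rfl (fun i _ => ?_)
    rw [mul_assoc, (Commute.all B U).geom_sum₂_mul, mul_sub]

/-- `Γ(f^{∘n}) ≤ Γ(f)`: if a degree-1 polynomial `ℓ` satisfies `f^{∘n} ∘ ℓ = L ∘ f^{∘n}`
for some degree-1 polynomial `L`, then `f ∘ ℓ = L₁ ∘ f` for some degree-1 polynomial `L₁`. -/
theorem Gamma_iterate_subset {K : Type*} [Field K] [IsAlgClosed K] [CharZero K]
    (f : K[X]) (hf : 2 ≤ f.natDegree) (n : ℕ) (hn : 1 ≤ n)
    (ℓ L : K[X]) (hℓ : ℓ.degree = 1) (hL : L.degree = 1)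
    (h : (polyIter f n).comp ℓ = L.comp (polyIter f n)) :
    ∃ L₁ : K[X], L₁.degree = 1 ∧ f.comp ℓ = L₁.comp f := by
  obtain ⟨k, rfl⟩ : ∃ k, n = k + 1 := ⟨n - 1, by omega⟩
  have hm : 0 < f.natDegree := by omega
  have hℓ1 : ℓ.natDegree = 1 := natDegree_eq_of_degree_eq_some hℓ
  set m := f.natDegree with hmdef
  set A := polyIter f k with hAdef
  set B := f.comp ℓ with hBdef
  have hBm : B.natDegree = m := by rw [hBdef, natDegree_comp, hℓ1, mul_one]
  have hA : 0 < A.natDegree := natDegree_polyIter_pos f hm k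
  have hAB : A.comp B = (L.comp A).comp f := by
    rw [polyIter_succ_right, comp_assoc] at h
    rw [h, comp_assoc]
  have hfc : f.coeff m ≠ 0 := by
    rw [hmdef, coeff_natDegree, Ne, leadingCoeff_eq_zero]
    intro h0
    rw [hmdef, h0, natDegree_zero] at hm
    exact lt_irrefl _ hm
  have hBc : B.coeff m ≠ 0 := by
    rw [← hBm, coeff_natDegree, Ne, leadingCoeff_eq_zero]
    intro h0
    rw [h0] at hBm
    simp at hBm
    omega
  set c := B.coeff m / f.coeff m with hc
  have hc0 : c ≠ 0 := div_ne_zero hBc hfc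
  have hUu : (C c * f).coeff m = B.coeff m := by
    rw [coeff_C_mul, hc, div_mul_cancel₀ _ hfc]
  have hUm : (C c * f).natDegree ≤ m := natDegree_C_mul_le _ _
  obtain ⟨S, hS0, hSd, hS⟩ := exists_factor A B (C c * f) m hm (B.coeff m) hBc hA hBm.le hUm rfl hUu
  have hElt : (B - C c * f).natDegree < m := by
    have hle : (B - C c * f).natDegree ≤ m := (natDegree_sub_le_of_le hBm.le hUm).trans (max_self m).le
    refine lt_of_le_of_ne hle (fun he => ?_)
    have h0 : (B - C c * f).coeff m = 0 := by rw [coeff_sub, hUu, sub_self]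
    rw [← he, coeff_natDegree, leadingCoeff_eq_zero] at h0
    rw [h0] at he
    simp at he
    omega
  have hE : (B - C c * f).natDegree = 0 := by
    by_contra hE0
    have hEne : B - C c * f ≠ 0 := by
      intro h0
      rw [h0] at hE0
      simp at hE0
    have hG : A.comp B - A.comp (C c * f) = (L.comp A - A.comp (C c * X)).comp f := by
      rw [sub_comp, hAB, comp_assoc A]
      simp
    have hd := congrArg natDegree (hG.symm.trans hS)
    rw [natDegree_comp, natDegree_mul hS0 hEne, hSd] at hd
    have hdvd : m ∣ (B - C c * f).natDegree :=
      (Nat.dvd_add_right (Dvd.intro_left _ rfl)).1 (hd ▸ Dvd.intro_left _ rfl)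
    exact hE0 (Nat.eq_zero_of_dvd_of_lt hdvd hElt)
  rw [natDegree_eq_zero] at hE
  obtain ⟨e, he⟩ := hE
  refine ⟨C c * X + C e, degree_linear hc0, ?_⟩
  rw [add_comp, mul_comp, C_comp, C_comp, X_comp, he, add_sub_cancel]
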